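/- Let μ, λ be real constants, and let u : ℝ³×[0,∞) → ℝ³, ρ, p : ℝ³×[0,∞) → ℝ, F : ℝ³×[0,∞) → ℝ³ be smooth, with ρ everywhere positive, satisfying the momentum equation ρ(∂_t u + (u·∇)u) = μΔu − ∇(p − λφ) + ρF on ℝ³×(0,∞), where φ = ∇·u. Then the vorticity ω = ∇∧u satisfies on ℝ³×(0,∞), for each component i: ∂_t ω^i = Σ_j ∂_j( (μ/ρ) ∂_j ω^i ) − (u·∇)ω^i + (ω·∇)u^i − φ ω^i − μ Σ_j (∂_j(1/ρ)) ∂_i ω^j − (∇(1/ρ) ∧ ∇p)^i + (λ+μ)(∇(1/ρ) ∧ ∇φ)^i + (∇∧F)^i. -/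

import Mathlib

noncomputable section

/-- Spatial partial derivative in the `j`-th coordinate direction. -/
def pd (j : Fin 3) (f : (Fin 3 → ℝ) → ℝ) (x : Fin 3 → ℝ) : ℝ :=
  fderiv ℝ f x (Pi.single j 1)

/-- The Levi-Civita symbol on `Fin 3`. -/
def eps (i j k : Fin 3) : ℝ :=
  (((j : ℕ) : ℝ) - ((i : ℕ) : ℝ)) * (((k : ℕ) : ℝ) - ((i : ℕ) : ℝ)) *
    (((k : ℕ) : ℝ) - ((j : ℕ) : ℝ)) / 2

/-- The vorticity `ω(x,t) = ∇∧u(x,t)` of a time-dependent velocity field,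
`ω^i = Σ_{j,k} ε^{ijk} ∂_j u^k`. -/
def vort (u : (Fin 3 → ℝ) → ℝ → Fin 3 → ℝ) (x : Fin 3 → ℝ) (t : ℝ) (i : Fin 3) : ℝ :=
  ∑ j, ∑ k, eps i j k * pd j (fun y => u y t k) x

/-- The expansion rate `φ(x,t) = ∇·u(x,t)` of a time-dependent velocity field. -/
def expR (u : (Fin 3 → ℝ) → ℝ → Fin 3 → ℝ) (x : Fin 3 → ℝ) (t : ℝ) : ℝ :=
  ∑ i, pd i (fun y => u y t i) x

open scoped ContDiff

/-- smooth scalar function on space -/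
def Smo (f : (Fin 3 → ℝ) → ℝ) : Prop := ContDiff ℝ ∞ f

lemma Smo.diff {f : (Fin 3 → ℝ) → ℝ} (h : Smo f) (x) : DifferentiableAt ℝ f x :=
  (ContDiff.differentiable h (by simp)) x

lemma Smo.pd {f : (Fin 3 → ℝ) → ℝ} (h : Smo f) (j : Fin 3) : Smo (pd j f) := by
  unfold Smo at *
  have : ContDiff ℝ ∞ (fderiv ℝ f) := h.fderiv_right (by simp)
  exact this.clm_apply contDiff_const

lemma Smo.pd' {f : (Fin 3 → ℝ) → ℝ} (h : Smo f) (j : Fin 3) : Smo (fun y => _root_.pd j f y) :=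
  h.pd j

lemma Smo.add {f g : (Fin 3 → ℝ) → ℝ} (hf : Smo f) (hg : Smo g) : Smo (fun y => f y + g y) :=
  ContDiff.add hf hg
lemma Smo.sub {f g : (Fin 3 → ℝ) → ℝ} (hf : Smo f) (hg : Smo g) : Smo (fun y => f y - g y) :=
  ContDiff.sub hf hg
lemma Smo.mul {f g : (Fin 3 → ℝ) → ℝ} (hf : Smo f) (hg : Smo g) : Smo (fun y => f y * g y) :=
  ContDiff.mul hf hg
lemma Smo.const (c : ℝ) : Smo (fun _ => c) := contDiff_const

lemma pd_add {f g : (Fin 3 → ℝ) → ℝ} (hf : Smo f) (hg : Smo g) (j x) :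
    pd j (fun y => f y + g y) x = pd j f x + pd j g x := by
  simp [pd, fderiv_fun_add (hf.diff x) (hg.diff x)]
lemma pd_sub {f g : (Fin 3 → ℝ) → ℝ} (hf : Smo f) (hg : Smo g) (j x) :
    pd j (fun y => f y - g y) x = pd j f x - pd j g x := by
  simp [pd, fderiv_fun_sub (hf.diff x) (hg.diff x)]
lemma pd_mul {f g : (Fin 3 → ℝ) → ℝ} (hf : Smo f) (hg : Smo g) (j x) :
    pd j (fun y => f y * g y) x = f x * pd j g x + g x * pd j f x := by
  simp [pd, fderiv_fun_mul (hf.diff x) (hg.diff x)]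
lemma pd_cmul {f : (Fin 3 → ℝ) → ℝ} (c : ℝ) (hf : Smo f) (j x) :
    pd j (fun y => c * f y) x = c * pd j f x := by
  simp [pd, fderiv_const_mul (hf.diff x)]

lemma pd_add' {f g : (Fin 3 → ℝ) → ℝ} (hf : Smo f) (hg : Smo g) (j) :
    pd j (fun y => f y + g y) = fun x => pd j f x + pd j g x := by
  ext x; exact pd_add hf hg j x
lemma pd_sub' {f g : (Fin 3 → ℝ) → ℝ} (hf : Smo f) (hg : Smo g) (j) :
    pd j (fun y => f y - g y) = fun x => pd j f x - pd j g x := by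
  ext x; exact pd_sub hf hg j x
lemma pd_mul' {f g : (Fin 3 → ℝ) → ℝ} (hf : Smo f) (hg : Smo g) (j) :
    pd j (fun y => f y * g y) = fun x => f x * pd j g x + g x * pd j f x := by
  ext x; exact pd_mul hf hg j x
lemma pd_const (c : ℝ) (j) : pd j (fun _ => c) = fun _ => 0 := by
  ext x; simp [pd]

/-- Schwarz for a general normed space. -/
lemma schwarz {E : Type*} [NormedAddCommGroup E] [NormedSpace ℝ E] {f : E → ℝ} {x : E}
    (h : ContDiffAt ℝ ∞ f x) (v w : E) :
    fderiv ℝ (fun y => fderiv ℝ f y v) x w = fderiv ℝ (fun y => fderiv ℝ f y w) x v := by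
  have hd : DifferentiableAt ℝ (fderiv ℝ f) x :=
    (h.fderiv_right (m := 1) (by norm_cast)).differentiableAt (by simp)
  have hs : IsSymmSndFDerivAt ℝ f x := h.isSymmSndFDerivAt (by simp; norm_cast)
  rw [fderiv_clm_apply hd (by fun_prop), fderiv_clm_apply hd (by fun_prop)]
  simpa using hs.eq w v

lemma pd_comm {f : (Fin 3 → ℝ) → ℝ} (hf : Smo f) (j k) : pd j (pd k f) = pd k (pd j f) := by
  ext x
  exact schwarz (ContDiff.contDiffAt hf) _ _

lemma fderiv_slice {f : (Fin 3 → ℝ) × ℝ → ℝ} {x : Fin 3 → ℝ} {t : ℝ}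
    (h : DifferentiableAt ℝ f (x, t)) (j : Fin 3) :
    pd j (fun y => f (y, t)) x = fderiv ℝ f (x, t) (Pi.single j 1, 0) := by
  have h1 : HasFDerivAt (fun y : Fin 3 → ℝ => (y, t))
      (ContinuousLinearMap.inl ℝ (Fin 3 → ℝ) ℝ) x := hasFDerivAt_prodMk_left x t
  have := (HasFDerivAt.comp x h.hasFDerivAt h1).fderiv
  unfold pd
  change fderiv ℝ (f ∘ fun y => (y, t)) x _ = _
  rw [this]; simp

lemma deriv_slice {f : (Fin 3 → ℝ) × ℝ → ℝ} {x : Fin 3 → ℝ} {t : ℝ}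
    (h : DifferentiableAt ℝ f (x, t)) :
    HasDerivAt (fun s => f (x, s)) (fderiv ℝ f (x, t) (0, 1)) t := by
  have h1 : HasDerivAt (fun s : ℝ => (x, s)) ((0 : Fin 3 → ℝ), (1 : ℝ)) t :=
    (hasDerivAt_const t x).prodMk (hasDerivAt_id t)
  exact h.hasFDerivAt.comp_hasDerivAt t h1

lemma swap_tx {f : (Fin 3 → ℝ) × ℝ → ℝ}
    (h : ∀ x t, 0 < t → ContDiffAt ℝ ∞ f (x, t)) (x : Fin 3 → ℝ) (t : ℝ) (ht : 0 < t) (j : Fin 3) :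
    HasDerivAt (fun s => pd j (fun y => f (y, s)) x)
      (pd j (fun y => deriv (fun s => f (y, s)) t) x) t := by
  have hd : ∀ x t, 0 < t → DifferentiableAt ℝ f (x, t) :=
    fun x t ht => (h x t ht).differentiableAt (by simp)
  have hdd : DifferentiableAt ℝ (fderiv ℝ f) (x, t) :=
    ((h x t ht).fderiv_right (m := 1) (by norm_cast)).differentiableAt (by simp)
  have hdv : ∀ v, DifferentiableAt ℝ (fun q => fderiv ℝ f q v) (x, t) :=
    fun v => hdd.clm_apply (by fun_prop)
  have e1 : (fun y => deriv (fun s => f (y, s)) t) = fun y => fderiv ℝ f (y, t) (0, 1) := by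
    ext y; exact (deriv_slice (hd y t ht)).deriv
  rw [e1, fderiv_slice (f := fun q => fderiv ℝ f q (0, 1)) (hdv _) j, schwarz (h x t ht)]
  refine (deriv_slice (hdv (Pi.single j 1, 0))).congr_of_eventuallyEq ?_
  filter_upwards [lt_mem_nhds ht] with s hs
  exact fderiv_slice (hd x s hs) j

lemma spatial (μ lam : ℝ) (U G : Fin 3 → (Fin 3 → ℝ) → ℝ) (R P : (Fin 3 → ℝ) → ℝ)
    (hU : ∀ k, Smo (U k)) (hG : ∀ k, Smo (G k)) (hR : Smo R) (hP : Smo P)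
    (W : Fin 3 → (Fin 3 → ℝ) → ℝ) (hW : ∀ i, W i = fun y => ∑ j, ∑ k, eps i j k * pd j (U k) y)
    (φ : (Fin 3 → ℝ) → ℝ) (hφ : φ = fun y => ∑ j, pd j (U j) y)
    (A : Fin 3 → (Fin 3 → ℝ) → ℝ)
    (hA : ∀ k, A k = fun y => R y * (μ * (∑ j, pd j (pd j (U k)) y)
       - pd k (fun y => P y - lam * φ y) y) + G k y - ∑ j, U j y * pd j (U k) y)
    (x : Fin 3 → ℝ) (i : Fin 3) :
    ∑ j, ∑ k, eps i j k * pd j (A k) x =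
      (∑ j, pd j (fun y => (μ * R y) * pd j (W i) y) x)
          - (∑ j, U j x * pd j (W i) x)
          + (∑ j, W j x * pd j (U i) x)
          - φ x * W i x
          - μ * (∑ j, pd j R x * pd i (W j) x)
          - (∑ j, ∑ k, eps i j k * pd j R x * pd k P x)
          + (lam + μ) * (∑ j, ∑ k, eps i j k * pd j R x * pd k φ x)
          + (∑ j, ∑ k, eps i j k * pd j (G k) x) := by
  have h10 : ∀ f, Smo f → pd 1 (pd 0 f) = pd 0 (pd 1 f) := fun f hf => pd_comm hf _ _
  have h20 : ∀ f, Smo f → pd 2 (pd 0 f) = pd 0 (pd 2 f) := fun f hf => pd_comm hf _ _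
  have h21 : ∀ f, Smo f → pd 2 (pd 1 f) = pd 1 (pd 2 f) := fun f hf => pd_comm hf _ _
  have W0 : W 0 = fun y => pd 1 (U 2) y - pd 2 (U 1) y := by
    rw [hW]; ext y; simp [Fin.sum_univ_three, eps]; ring
  have W1 : W 1 = fun y => pd 2 (U 0) y - pd 0 (U 2) y := by
    rw [hW]; ext y; simp [Fin.sum_univ_three, eps]; ring
  have W2 : W 2 = fun y => pd 0 (U 1) y - pd 1 (U 0) y := by
    rw [hW]; ext y; simp [Fin.sum_univ_three, eps]; ring
  simp only [Fin.sum_univ_three] at hφ hA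
  fin_cases i <;>
  · simp only [Fin.zero_eta, Fin.mk_one, Fin.reduceFinMk, Fin.sum_univ_three, W0, W1, W2, hφ, hA]
    simp (maxDischargeDepth := 20) only [pd_add', pd_sub', pd_mul', pd_const, hU, hG, hR, hP, Smo.pd, Smo.pd', Smo.add,
      Smo.sub, Smo.mul, Smo.const, h10, h20, h21]
    simp [eps]
    ring


/-- The vorticity equation for a viscous compressible fluid flow, component `i`:
`∂_t ω^i = Σ_j ∂_j((μ/ρ)∂_j ω^i) − (u·∇)ω^i + (ω·∇)u^i − φω^i
  − μ Σ_j (∂_j(1/ρ)) ∂_i ω^j − (∇(1/ρ)∧∇p)^i + (λ+μ)(∇(1/ρ)∧∇φ)^i + (∇∧F)^i`. -/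
theorem statement_8 (μ lam : ℝ) (u : (Fin 3 → ℝ) → ℝ → Fin 3 → ℝ)
    (ρ pr : (Fin 3 → ℝ) → ℝ → ℝ) (F : (Fin 3 → ℝ) → ℝ → Fin 3 → ℝ)
    (hu : ContDiffOn ℝ (⊤ : ℕ∞) (fun q : (Fin 3 → ℝ) × ℝ => u q.1 q.2) {q | 0 ≤ q.2})
    (hρ : ContDiffOn ℝ (⊤ : ℕ∞) (fun q : (Fin 3 → ℝ) × ℝ => ρ q.1 q.2) {q | 0 ≤ q.2})
    (hpr : ContDiffOn ℝ (⊤ : ℕ∞) (fun q : (Fin 3 → ℝ) × ℝ => pr q.1 q.2) {q | 0 ≤ q.2})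
    (hF : ContDiffOn ℝ (⊤ : ℕ∞) (fun q : (Fin 3 → ℝ) × ℝ => F q.1 q.2) {q | 0 ≤ q.2})
    (hpos : ∀ x t, 0 ≤ t → 0 < ρ x t)
    (hmom : ∀ (x : Fin 3 → ℝ) (t : ℝ), 0 < t → ∀ i,
      ρ x t * (deriv (fun s => u x s i) t + ∑ j, u x t j * pd j (fun y => u y t i) x)
        = μ * (∑ j, pd j (pd j (fun y => u y t i)) x)
          - pd i (fun y => pr y t - lam * expR u y t) x + ρ x t * F x t i) :
    ∀ (x : Fin 3 → ℝ) (t : ℝ), 0 < t → ∀ i,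
      deriv (fun s => vort u x s i) t
        = (∑ j, pd j (fun y => (μ / ρ y t) * pd j (fun z => vort u z t i) y) x)
          - (∑ j, u x t j * pd j (fun y => vort u y t i) x)
          + (∑ j, vort u x t j * pd j (fun y => u y t i) x)
          - expR u x t * vort u x t i
          - μ * (∑ j, pd j (fun y => (ρ y t)⁻¹) x * pd i (fun y => vort u y t j) x)
          - (∑ j, ∑ k, eps i j k *
              pd j (fun y => (ρ y t)⁻¹) x * pd k (fun y => pr y t) x)
          + (lam + μ) * (∑ j, ∑ k, eps i j k *
              pd j (fun y => (ρ y t)⁻¹) x * pd k (fun y => expR u y t) x)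
          + (∑ j, ∑ k, eps i j k * pd j (fun y => F y t k) x) := by
  intro x t ht i
  have hnh : ∀ (x : Fin 3 → ℝ) (t : ℝ), 0 < t →
      {q : (Fin 3 → ℝ) × ℝ | 0 ≤ q.2} ∈ nhds (x, t) := by
    intro x t ht
    have : {q : (Fin 3 → ℝ) × ℝ | 0 < q.2} ∈ nhds (x, t) :=
      (isOpen_lt continuous_const continuous_snd).mem_nhds ht
    exact Filter.mem_of_superset this fun q (hq : 0 < q.2) => show 0 ≤ q.2 from le_of_lt hq
  have hu' : ∀ k x t, 0 < t →
      ContDiffAt ℝ ∞ (fun q : (Fin 3 → ℝ) × ℝ => u q.1 q.2 k) (x, t) := fun k x t ht =>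
    contDiffAt_pi.1 (hu.contDiffAt (hnh x t ht)) k
  have hF' : ∀ k x t, 0 < t →
      ContDiffAt ℝ ∞ (fun q : (Fin 3 → ℝ) × ℝ => F q.1 q.2 k) (x, t) := fun k x t ht =>
    contDiffAt_pi.1 (hF.contDiffAt (hnh x t ht)) k
  have slice : ∀ f : (Fin 3 → ℝ) × ℝ → ℝ, (∀ x t, 0 < t → ContDiffAt ℝ ∞ f (x, t)) →
      Smo (fun y => f (y, t)) := by
    intro f hf
    refine contDiff_iff_contDiffAt.2 fun y => ?_
    exact ContDiffAt.comp y (hf y t ht) (contDiffAt_id.prodMk contDiffAt_const)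
  have hU : ∀ k, Smo (fun y => u y t k) := fun k => slice _ (hu' k)
  have hG : ∀ k, Smo (fun y => F y t k) := fun k => slice _ (hF' k)
  have hP : Smo (fun y => pr y t) := slice _ fun x t ht => hpr.contDiffAt (hnh x t ht)
  have hR : Smo (fun y => (ρ y t)⁻¹) := 
    ContDiff.inv (slice _ fun x t ht => hρ.contDiffAt (hnh x t ht))
      fun y => (hpos y t ht.le).ne'
  have hL : deriv (fun s => vort u x s i) t =
      ∑ j, ∑ k, eps i j k * pd j (fun y => deriv (fun s => u y s k) t) x := by
    refine HasDerivAt.deriv ?_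
    unfold vort
    refine HasDerivAt.fun_sum fun j _ => HasDerivAt.fun_sum fun k _ => ?_
    exact (swap_tx (hu' k) x t ht j).const_mul _
  rw [hL]
  have := spatial μ lam (fun k y => u y t k) (fun k y => F y t k) (fun y => (ρ y t)⁻¹)
    (fun y => pr y t) hU hG hR hP (fun i y => vort u y t i) (fun i => rfl)
    (fun y => expR u y t) rfl (fun k y => deriv (fun s => u y s k) t) ?_ x i
  · simpa only [div_eq_mul_inv] using this
  · intro k
    ext y
    have h := hmom y t ht k
    have h0 := (hpos y t ht.le).ne'
    field_simp
    linear_combination h
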